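/- The ℂ-vector space of invariant homogeneous polynomials of degree 12 in the polynomial ring ℂ[x_{ijk}] with variables indexed by (i,j,k) ∈ {1,2,3} × {1,2,3} × {1,2} has dimension exactly 1. (A basis vector is, up to sign, the hyperdeterminant of a 3 × 3 × 2 array.) -/

import Mathlib

open MvPolynomial

/-- The derivation `D_{A,B,C}` of `ℂ[x_{ijk}]` (format `3 × 3 × 2`) determined on variables by
`D(x_{ijk}) = Σ_{i'} A_{i'i} x_{i'jk} + Σ_{j'} B_{j'j} x_{ij'k} + Σ_{k'} C_{k'k} x_{ijk'}`. -/
noncomputable def liederiv (A : Matrix (Fin 3) (Fin 3) ℂ) (B : Matrix (Fin 3) (Fin 3) ℂ)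
    (C : Matrix (Fin 2) (Fin 2) ℂ) :
    Derivation ℂ (MvPolynomial (Fin 3 × Fin 3 × Fin 2) ℂ)
      (MvPolynomial (Fin 3 × Fin 3 × Fin 2) ℂ) :=
  mkDerivation ℂ fun v =>
    (∑ i' : Fin 3, A i' v.1 • X (i', v.2.1, v.2.2)) +
    (∑ j' : Fin 3, B j' v.2.1 • X (v.1, j', v.2.2)) +
    (∑ k' : Fin 2, C k' v.2.2 • X (v.1, v.2.1, k'))

/-- A polynomial is invariant if it is annihilated by every derivation `D_{A,B,C}` with
`A`, `B`, `C` traceless. -/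
def InvariantPoly (f : MvPolynomial (Fin 3 × Fin 3 × Fin 2) ℂ) : Prop :=
  ∀ (A : Matrix (Fin 3) (Fin 3) ℂ) (B : Matrix (Fin 3) (Fin 3) ℂ)
    (C : Matrix (Fin 2) (Fin 2) ℂ), A.trace = 0 → B.trace = 0 → C.trace = 0 →
      liederiv A B C f = 0

section Generic

variable {σ K : Type*} [Field K]

lemma MvPolynomial.derivation_eq_sum_pderiv
    [Fintype σ] (D : Derivation K (MvPolynomial σ K) (MvPolynomial σ K)) (f : MvPolynomial σ K) :
    D f = ∑ i, D (X i) * pderiv i f := by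
  classical
  have hsum : ∀ g, (∑ i, D (X i) • pderiv i : Derivation K (MvPolynomial σ K) (MvPolynomial σ K)) g
      = ∑ i, D (X i) * pderiv i g := fun g => by
    rw [← Derivation.coeFnAddMonoidHom_apply, map_sum, Finset.sum_apply]
    simp
  have h : D = ∑ i, D (X i) • pderiv i :=
    derivation_ext fun j => by simp [hsum, pderiv_X, Pi.single_apply]
  conv_lhs => rw [h]
  exact hsum f

/-- The restriction of polynomials to the parametrised line `t ↦ x + t v`. -/
noncomputable def lineRestriction (x v : σ → K) : MvPolynomial σ K →ₐ[K] Polynomial K :=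
  aeval fun i => Polynomial.C (x i) + Polynomial.X * Polynomial.C (v i)

lemma eval_lineRestriction (x v : σ → K) (f : MvPolynomial σ K) (t : K) :
    (lineRestriction x v f).eval t = eval (fun i => x i + t * v i) f := by
  induction f using MvPolynomial.induction_on with
  | C a => simp [lineRestriction]
  | add p q hp hq => simp [hp, hq]
  | mul_X p i hp => simp [hp, mul_comm t]; simp [lineRestriction]

lemma derivative_lineRestriction [Fintype σ] (x v : σ → K) (f : MvPolynomial σ K) :
    (lineRestriction x v f).derivative =
      ∑ i, Polynomial.C (v i) * lineRestriction x v (pderiv i f) := by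
  classical
  induction f using MvPolynomial.induction_on with
  | C a => simp [lineRestriction]
  | add p q hp hq => simp [hp, hq, mul_add, Finset.sum_add_distrib]
  | mul_X p i hp =>
    have hX : (lineRestriction x v (X i)).derivative = Polynomial.C (v i) := by
      simp [lineRestriction]
    have hterm : ∀ j, Polynomial.C (v j) * lineRestriction x v (pderiv j (p * X i)) =
        Polynomial.C (v j) * lineRestriction x v (pderiv j p) * lineRestriction x v (X i) +
          if j = i then lineRestriction x v p * Polynomial.C (v i) else 0 := by
      intro j
      rw [pderiv_mul, pderiv_X]
      by_cases h : j = i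
      · subst h; simp; ring
      · rw [Pi.single_eq_of_ne (Ne.symm h)]; simp [h]; ring
    simp only [hterm, Finset.sum_add_distrib, ← Finset.sum_mul, ← hp]
    simp [Polynomial.derivative_mul, hX]

lemma Polynomial.eq_zero_of_mul_derivative_eq_mul [CharZero K] {q F p : Polynomial K}
    (h : q * F.derivative = F * p) (hq : q.eval 0 ≠ 0) (hF : F.eval 0 = 0) : F = 0 := by
  by_contra hne
  obtain ⟨G, hG, hndvd⟩ := Polynomial.exists_eq_pow_rootMultiplicity_mul_and_not_dvd F hne 0
  rw [Polynomial.C_0, sub_zero] at hG hndvd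
  have hpos : 0 < F.rootMultiplicity 0 := (Polynomial.rootMultiplicity_pos hne).2 hF
  obtain ⟨n, hn⟩ := Nat.exists_eq_succ_of_ne_zero hpos.ne'
  rw [hn] at hG
  have hG0 : G.eval 0 ≠ 0 := by
    rwa [Polynomial.X_dvd_iff, Polynomial.coeff_zero_eq_eval_zero] at hndvd
  have hcancel : Polynomial.X ^ n * (q * (((n : Polynomial K) + 1) * G +
      Polynomial.X * G.derivative)) = Polynomial.X ^ n * (Polynomial.X * G * p) := by
    rw [hG] at h
    simp only [Polynomial.derivative_mul, Polynomial.derivative_X_pow_succ] at h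
    simp only [map_add, Polynomial.C_1, map_natCast, Nat.succ_eq_add_one, pow_succ] at h
    linear_combination h
  have h0 := congrArg (Polynomial.eval 0)
    (mul_left_cancel₀ (pow_ne_zero n Polynomial.X_ne_zero) hcancel)
  simp [hq, hG0] at h0
  exact absurd h0 (by exact_mod_cast n.succ_ne_zero)

/-- A polynomial that is an eigenvector of derivations spanning the tangent space at a point `x`
vanishes identically as soon as it vanishes at `x`. -/
lemma MvPolynomial.eq_zero_of_eigenvector_of_eval_eq_zero [CharZero K] [Fintype σ]
    [DecidableEq σ]
    (f : MvPolynomial σ K) (x : σ → K)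
    (D : σ → Derivation K (MvPolynomial σ K) (MvPolynomial σ K)) (χ : σ → K)
    (hD : ∀ w, D w f = χ w • f)
    (hx : ∀ w i, eval x (D w (X i)) = (1 : Matrix σ σ K) w i) (hf : eval x f = 0) : f = 0 := by
  refine MvPolynomial.funext fun y => ?_
  set v : σ → K := fun i => y i - x i
  set φ := lineRestriction x v
  let M : Matrix σ σ (Polynomial K) := Matrix.of fun w i => φ (D w (X i))
  have hM : M.mulVec (fun i => φ (pderiv i f)) = φ f • fun w => Polynomial.C (χ w) := by
    ext1 w
    have h := congrArg φ (hD w)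
    rw [derivation_eq_sum_pderiv, map_sum, map_smul] at h
    simp only [map_mul] at h
    simp only [Matrix.mulVec, dotProduct, M, Matrix.of_apply, h, Pi.smul_apply, smul_eq_mul]
    rw [Polynomial.smul_eq_C_mul, mul_comm]
  have hdet : M.det.eval 0 = 1 := by
    have h1 : (Polynomial.evalRingHom (0 : K)).mapMatrix M = 1 := by
      ext w i
      simp [M, φ, eval_lineRestriction, hx]
    have h2 := RingHom.map_det (Polynomial.evalRingHom (0 : K)) M
    rw [h1, Matrix.det_one] at h2
    simpa using h2
  have hadj : M.det • (fun i => φ (pderiv i f)) =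
      φ f • M.adjugate.mulVec fun w => Polynomial.C (χ w) := by
    rw [← Matrix.mulVec_smul, ← hM, Matrix.mulVec_mulVec, Matrix.adjugate_mul,
      Matrix.smul_mulVec, Matrix.one_mulVec]
  have hF : φ f = 0 := by
    refine Polynomial.eq_zero_of_mul_derivative_eq_mul (q := M.det)
      (p := ∑ i, Polynomial.C (v i) * M.adjugate.mulVec (fun w => Polynomial.C (χ w)) i)
      ?_ (by simp [hdet]) (by simpa [φ, eval_lineRestriction] using hf)
    rw [derivative_lineRestriction, Finset.mul_sum, Finset.mul_sum]
    refine Finset.sum_congr rfl fun i _ => ?_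
    have h := congrFun hadj i
    simp only [Pi.smul_apply, smul_eq_mul] at h
    linear_combination Polynomial.C (v i) * h
  have h1 := eval_lineRestriction x v f 1
  rw [show lineRestriction x v f = 0 from hF] at h1
  simpa [v] using h1.symm

end Generic

section Hyperdeterminant

lemma liederiv_X (A B : Matrix (Fin 3) (Fin 3) ℂ) (C' : Matrix (Fin 2) (Fin 2) ℂ)
    (i j : Fin 3) (k : Fin 2) :
    liederiv A B C' (X (i, j, k)) =
      (∑ i', A i' i • X (i', j, k)) + (∑ j', B j' j • X (i, j', k)) +
        ∑ k', C' k' k • X (i, j, k') := by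
  simp [liederiv]

lemma liederiv_smul_one_apply (a b c : ℂ) {f : MvPolynomial (Fin 3 × Fin 3 × Fin 2) ℂ} {n : ℕ}
    (hf : f.IsHomogeneous n) :
    liederiv (a • 1) (b • 1) (c • 1) f = ((a + b + c) * n) • f := by
  have hX : ∀ v, liederiv (a • 1) (b • 1) (c • 1) (X v) = (a + b + c) • X v := by
    rintro ⟨i, j, k⟩
    rw [liederiv_X]
    simp [Matrix.one_apply, add_smul]
  rw [derivation_eq_sum_pderiv]
  simp only [hX, smul_mul_assoc, ← Finset.smul_sum, hf.sum_X_mul_pderiv, mul_smul]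
  simp [Algebra.smul_def]

lemma liederiv_add (A A' B B' : Matrix (Fin 3) (Fin 3) ℂ) (C' C'' : Matrix (Fin 2) (Fin 2) ℂ) :
    liederiv (A + A') (B + B') (C' + C'') = liederiv A B C' + liederiv A' B' C'' := by
  refine derivation_ext ?_
  rintro ⟨i, j, k⟩
  rw [Derivation.add_apply, liederiv_X, liederiv_X, liederiv_X]
  simp only [Matrix.add_apply, add_smul, Finset.sum_add_distrib]
  abel

lemma InvariantPoly.exists_liederiv_eq_smul {f : MvPolynomial (Fin 3 × Fin 3 × Fin 2) ℂ} {n : ℕ}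
    (hf : f.IsHomogeneous n) (hinv : InvariantPoly f) (A B : Matrix (Fin 3) (Fin 3) ℂ)
    (C' : Matrix (Fin 2) (Fin 2) ℂ) : ∃ χ : ℂ, liederiv A B C' f = χ • f := by
  have h0 := hinv (A - (A.trace / 3) • 1) (B - (B.trace / 3) • 1) (C' - (C'.trace / 2) • 1)
    (by simp) (by simp) (by simp)
  have h := liederiv_add (A - (A.trace / 3) • 1) ((A.trace / 3) • 1) (B - (B.trace / 3) • 1)
    ((B.trace / 3) • 1) (C' - (C'.trace / 2) • 1) ((C'.trace / 2) • 1)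
  simp only [sub_add_cancel] at h
  exact ⟨_, by rw [h, Derivation.add_apply, h0, zero_add, liederiv_smul_one_apply _ _ _ hf]⟩

/-- The array whose slices are the identity matrix and `diag(0, 1, -1)`. -/
def diagonalPencil (v : Fin 3 × Fin 3 × Fin 2) : ℂ :=
  if v.1 = v.2.1 then ![1, (![0, 1, -1] : Fin 3 → ℂ) v.1] v.2.2 else 0

lemma exists_liederiv_eval_diagonalPencil (u : Fin 3 × Fin 3 × Fin 2 → ℂ) :
    ∃ (A B : Matrix (Fin 3) (Fin 3) ℂ) (C' : Matrix (Fin 2) (Fin 2) ℂ),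
      ∀ v, eval diagonalPencil (liederiv A B C' (X v)) = u v := by
  let y : Fin 3 → ℂ := ![0, 1, -1]
  let r : Fin 3 → ℂ := fun i => u (i, i, 1) - y i * u (i, i, 0)
  let a : Matrix (Fin 3) (Fin 3) ℂ :=
    Matrix.of fun i j => (u (i, j, 1) - y i * u (i, j, 0)) / (y j - y i)
  let c : ℂ := r 0 - (r 1 + r 2) / 2
  refine ⟨a.transpose, Matrix.of (fun i j => u (i, j, 0)) - a - c • Matrix.diagonal y,
    !![0, r 0; c, (r 1 - r 2) / 2], ?_⟩
  rintro ⟨i, j, k⟩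
  rw [liederiv_X]
  fin_cases i <;> fin_cases j <;> fin_cases k <;>
    simp [Fin.sum_univ_three, Fin.sum_univ_two, diagonalPencil, a, c, r, y, smul_eval] <;> ring

lemma InvariantPoly.eq_zero_of_eval_diagonalPencil_eq_zero
    {f : MvPolynomial (Fin 3 × Fin 3 × Fin 2) ℂ} {n : ℕ} (hf : f.IsHomogeneous n)
    (hinv : InvariantPoly f) (h0 : eval diagonalPencil f = 0) : f = 0 := by
  choose A B C' h using fun w =>
    exists_liederiv_eval_diagonalPencil ((1 : Matrix (Fin 3 × Fin 3 × Fin 2) (Fin 3 × Fin 3 × Fin 2) ℂ) w)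
  choose χ hχ using fun w => hinv.exists_liederiv_eq_smul hf (A w) (B w) (C' w)
  exact eq_zero_of_eigenvector_of_eval_eq_zero f diagonalPencil
    (fun w => liederiv (A w) (B w) (C' w)) χ hχ h h0

/-- The determinant of the `3 × 3` matrix whose `i`-th row is taken from the slice `s i`. -/
noncomputable def mixedDet (s : Fin 3 → Fin 2) : MvPolynomial (Fin 3 × Fin 3 × Fin 2) ℂ :=
  Matrix.det (Matrix.of fun i j => X (i, j, s i))

lemma isHomogeneous_mixedDet (s : Fin 3 → Fin 2) : (mixedDet s).IsHomogeneous 3 := by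
  rw [mixedDet, Matrix.det_apply']
  refine IsHomogeneous.sum _ _ _ fun p _ => ?_
  have hsign : ((Equiv.Perm.sign p : ℤ) : MvPolynomial (Fin 3 × Fin 3 × Fin 2) ℂ) =
      C ((Equiv.Perm.sign p : ℤ) : ℂ) := by simp
  rw [hsign]
  refine IsHomogeneous.C_mul ?_ _
  exact IsHomogeneous.prod Finset.univ _ (fun _ => 1) fun i _ => isHomogeneous_X _ _

/-- The coefficients of the binary cubic form `det (s X₀ + t X₁)` in the slices `X₀`, `X₁`. -/
noncomputable def pencilCoeff : Fin 4 → MvPolynomial (Fin 3 × Fin 3 × Fin 2) ℂ :=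
  ![mixedDet ![0, 0, 0],
    mixedDet ![1, 0, 0] + mixedDet ![0, 1, 0] + mixedDet ![0, 0, 1],
    mixedDet ![0, 1, 1] + mixedDet ![1, 0, 1] + mixedDet ![1, 1, 0],
    mixedDet ![1, 1, 1]]

lemma isHomogeneous_pencilCoeff (m : Fin 4) : (pencilCoeff m).IsHomogeneous 3 := by
  have h := isHomogeneous_mixedDet
  fin_cases m
  · exact h _
  · exact ((h _).add (h _)).add (h _)
  · exact ((h _).add (h _)).add (h _)
  · exact h _

lemma liederiv_pencilCoeff (A B : Matrix (Fin 3) (Fin 3) ℂ) (C' : Matrix (Fin 2) (Fin 2) ℂ)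
    (hA : A.trace = 0) (hB : B.trace = 0) :
    liederiv A B C' (pencilCoeff 0) =
        C (3 * C' 0 0) * pencilCoeff 0 + C (C' 1 0) * pencilCoeff 1 ∧
      liederiv A B C' (pencilCoeff 1) = C (3 * C' 0 1) * pencilCoeff 0 +
        C (2 * C' 0 0 + C' 1 1) * pencilCoeff 1 + C (2 * C' 1 0) * pencilCoeff 2 ∧
      liederiv A B C' (pencilCoeff 2) = C (2 * C' 0 1) * pencilCoeff 1 +
        C (C' 0 0 + 2 * C' 1 1) * pencilCoeff 2 + C (3 * C' 1 0) * pencilCoeff 3 ∧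
      liederiv A B C' (pencilCoeff 3) =
        C (C' 0 1) * pencilCoeff 2 + C (3 * C' 1 1) * pencilCoeff 3 := by
  rw [Matrix.trace_fin_three] at hA hB
  obtain hA : A 2 2 = -A 0 0 - A 1 1 := by linear_combination hA
  obtain hB : B 2 2 = -B 0 0 - B 1 1 := by linear_combination hB
  refine ⟨?_, ?_, ?_, ?_⟩ <;>
  · simp only [pencilCoeff, mixedDet, Matrix.det_fin_three, Matrix.of_apply, Matrix.cons_val,
      map_add, map_sub, Derivation.leibniz, liederiv_X, Fin.sum_univ_three, Fin.sum_univ_two,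
      smul_eq_mul, smul_eq_C_mul, hA, hB, map_neg, map_mul, map_ofNat]
    ring

/-- The hyperdeterminant of a `3 × 3 × 2` array: the discriminant of the binary cubic form
`det (s X₀ + t X₁)`. -/
noncomputable def hyperdet : MvPolynomial (Fin 3 × Fin 3 × Fin 2) ℂ :=
  pencilCoeff 1 ^ 2 * pencilCoeff 2 ^ 2 - C 4 * (pencilCoeff 0 * pencilCoeff 2 ^ 3) -
    C 4 * (pencilCoeff 1 ^ 3 * pencilCoeff 3) +
    C 18 * (pencilCoeff 0 * pencilCoeff 1 * (pencilCoeff 2 * pencilCoeff 3)) -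
    C 27 * (pencilCoeff 0 ^ 2 * pencilCoeff 3 ^ 2)

lemma isHomogeneous_hyperdet : hyperdet.IsHomogeneous 12 := by
  have h := isHomogeneous_pencilCoeff
  exact (((((h 1).pow 2).mul ((h 2).pow 2)).sub (((h 0).mul ((h 2).pow 3)).C_mul 4)).sub
    ((((h 1).pow 3).mul (h 3)).C_mul 4)).add
    ((((h 0).mul (h 1)).mul ((h 2).mul (h 3))).C_mul 18) |>.sub
    ((((h 0).pow 2).mul ((h 3).pow 2)).C_mul 27)

lemma invariantPoly_hyperdet : InvariantPoly hyperdet := by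
  intro A B C' hA hB hC
  obtain ⟨h0, h1, h2, h3⟩ := liederiv_pencilCoeff A B C' hA hB
  rw [Matrix.trace_fin_two] at hC
  obtain hC : C' 1 1 = -C' 0 0 := by linear_combination hC
  simp only [hyperdet, map_add, map_sub, Derivation.leibniz, Derivation.leibniz_pow, derivation_C,
    h0, h1, h2, h3, smul_eq_mul, nsmul_eq_mul, hC]
  simp only [map_neg, map_mul, map_ofNat]
  push_cast
  ring

lemma eval_diagonalPencil_hyperdet : eval diagonalPencil hyperdet = 4 := by
  simp [hyperdet, pencilCoeff, mixedDet, Matrix.det_fin_three, diagonalPencil]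
  norm_num

end Hyperdeterminant

/-- Theorem 15: the space of invariant homogeneous polynomials of degree 12 for
`3 × 3 × 2` arrays is one-dimensional (a basis vector is, up to sign, the
hyperdeterminant). -/
theorem invariants_degree_twelve_dim_one :
    ∃ f₀ : MvPolynomial (Fin 3 × Fin 3 × Fin 2) ℂ, f₀ ≠ 0 ∧ f₀.IsHomogeneous 12 ∧
      InvariantPoly f₀ ∧
      ∀ f : MvPolynomial (Fin 3 × Fin 3 × Fin 2) ℂ, f.IsHomogeneous 12 → InvariantPoly f →
        ∃ c : ℂ, f = c • f₀ := by
  refine ⟨hyperdet, fun h => ?_, isHomogeneous_hyperdet, invariantPoly_hyperdet,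
    fun f hf hinv => ⟨eval diagonalPencil f / 4, ?_⟩⟩
  · simpa [h] using eval_diagonalPencil_hyperdet
  · rw [← sub_eq_zero]
    refine InvariantPoly.eq_zero_of_eval_diagonalPencil_eq_zero (n := 12) ?_ ?_ ?_
    · rw [smul_eq_C_mul]
      exact hf.sub (isHomogeneous_hyperdet.C_mul _)
    · intro A B C' hA hB hC
      rw [map_sub, Derivation.map_smul, hinv A B C' hA hB hC,
        invariantPoly_hyperdet A B C' hA hB hC, smul_zero, sub_zero]
    · simp [smul_eval, eval_diagonalPencil_hyperdet]
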